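/- Let n ≥ 1, κ > 0, let μ0 be a finite nonnegative compactly supported Borel measure on ℝ^n absolutely continuous with respect to Lebesgue measure, μ1 a finite nonnegative compactly supported Borel measure, and let (v0, α0, μ1^⊥) be the HK logarithmic map components of μ1 at μ0. Define T'(x) = x + κ arctan((1/κ)·|v0(x)|/(1 + α0(x)/2))·v0(x)/|v0(x)| (with T'(x) = x when v0(x) = 0) and u(x) = √((1 + α0(x)/2)² + |v0(x)|²/κ²). Then T'_#(u²·μ0) + μ1^⊥ = μ1; that is, the HK exponential map at μ0 is a left inverse of the HK logarithmic map. -/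

import Mathlib

open MeasureTheory ENNReal Filter Topology RealInnerProductSpace
open scoped Classical

noncomputable section

abbrev Eucl (n : ℕ) : Type := EuclideanSpace ℝ (Fin n)

/-- Truncated cosine `Cos`. -/
def truncCos (s : ℝ) : ℝ := Real.cos (min |s| (Real.pi / 2))

/-- The Hellinger–Kantorovich cost function `c_κ`. -/
def cHK {n : ℕ} (κ : ℝ) (x y : Eucl n) : ℝ≥0∞ :=
  if dist x y < κ * Real.pi / 2 then
    ENNReal.ofReal (-2 * κ ^ 2 * Real.log (Real.cos (dist x y / κ)))
  else ⊤

/-- Kullback–Leibler divergence `KL(ρ|μ)`. -/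
def KLdiv {α : Type*} [MeasurableSpace α] (ρ μ : Measure α) : ℝ≥0∞ :=
  if ρ ≪ μ then
    ∫⁻ x, ENNReal.ofReal ((ρ.rnDeriv μ x).toReal * Real.log (ρ.rnDeriv μ x).toReal
      - (ρ.rnDeriv μ x).toReal + 1) ∂μ
  else ⊤

/-- The soft-marginal Hellinger–Kantorovich functional `E_κ(π|μ0,μ1)`. -/
def HKfun {n : ℕ} (κ : ℝ) (π : Measure (Eucl n × Eucl n)) (μ0 μ1 : Measure (Eucl n)) : ℝ≥0∞ :=
  ∫⁻ p, cHK κ p.1 p.2 ∂π + ENNReal.ofReal (κ ^ 2) * KLdiv (π.map Prod.fst) μ0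
    + ENNReal.ofReal (κ ^ 2) * KLdiv (π.map Prod.snd) μ1

/-- The squared Hellinger–Kantorovich distance `HK_κ²(μ0,μ1)`. -/
def HK2 {n : ℕ} (κ : ℝ) (μ0 μ1 : Measure (Eucl n)) : ℝ≥0∞ :=
  ⨅ (π : Measure (Eucl n × Eucl n)) (_ : IsFiniteMeasure π), HKfun κ π μ0 μ1

/-- The squared 2-Wasserstein distance `W2²(μ0,μ1)`. -/
def W2sq {n : ℕ} (μ0 μ1 : Measure (Eucl n)) : ℝ≥0∞ :=
  ⨅ (π : Measure (Eucl n × Eucl n))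
    (_ : π.map Prod.fst = μ0 ∧ π.map Prod.snd = μ1),
      ∫⁻ p, ENNReal.ofReal (dist p.1 p.2 ^ 2) ∂π

/-- Narrow convergence of a sequence of measures. -/
def NarrowTendsto {α : Type*} [MeasurableSpace α] [TopologicalSpace α]
    (ρ : ℕ → Measure α) (ρlim : Measure α) : Prop :=
  ∀ φ : BoundedContinuousFunction α ℝ,
    Tendsto (fun N => ∫ x, φ x ∂(ρ N)) atTop (𝓝 (∫ x, φ x ∂ρlim))

/-- The spherical Hellinger–Kantorovich distance `SHK_κ(μ0,μ1)`. -/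
def SHK {n : ℕ} (κ : ℝ) (μ0 μ1 : Measure (Eucl n)) : ℝ :=
  κ * Real.arccos (1 - (HK2 κ μ0 μ1).toReal / (2 * κ ^ 2))

/-- The square-root measure `√(ρσ)`. -/
def sqrtMeasure {α : Type*} [MeasurableSpace α] (ρ σ : Measure α) : Measure α :=
  (ρ + σ).withDensity (fun x => (ρ.rnDeriv (ρ + σ) x * σ.rnDeriv (ρ + σ) x) ^ (1/2 : ℝ))

/-- barycentric HK velocity. -/
def barV {n : ℕ} (κ : ℝ) (μ0 : Measure (Eucl n)) (π : Measure (Eucl n × Eucl n))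
    [IsFiniteMeasure π] (x : Eucl n) : Eucl n :=
  (κ * ((π.map Prod.fst).rnDeriv μ0 x).toReal) •
    ∫ y, (Real.tan (‖y - x‖ / κ) / ‖y - x‖) • (y - x) ∂(π.condKernel x)

/-- barycentric HK growth. -/
def barA {n : ℕ} (μ0 : Measure (Eucl n)) (π : Measure (Eucl n × Eucl n)) (x : Eucl n) : ℝ :=
  2 * (((π.map Prod.fst).rnDeriv μ0 x).toReal - 1)

/-- barycentric W2 velocity. -/
def barW {n : ℕ} (π : Measure (Eucl n × Eucl n)) [IsFiniteMeasure π] (x : Eucl n) : Eucl n :=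
  ∫ y, (y - x) ∂(π.condKernel x)

end

theorem measurable_cHK {n : ℕ} (κ : ℝ) :
    Measurable fun p : Eucl n × Eucl n => cHK κ p.1 p.2 := by
  unfold cHK
  refine Measurable.ite (measurableSet_lt (by fun_prop) (by fun_prop)) ?_ measurable_const
  refine ENNReal.measurable_ofReal.comp ?_
  refine measurable_const.mul (Real.measurable_log.comp ?_)
  exact Real.continuous_cos.measurable.comp (by fun_prop)

theorem KLdiv_zero_left {α : Type*} [MeasurableSpace α] (μ : Measure α) :
    KLdiv 0 μ = μ Set.univ := by
  rw [KLdiv, if_pos (Measure.AbsolutelyContinuous.zero μ)]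
  have : (fun x => ENNReal.ofReal (((0 : Measure α).rnDeriv μ x).toReal
      * Real.log ((0 : Measure α).rnDeriv μ x).toReal
      - ((0 : Measure α).rnDeriv μ x).toReal + 1)) =ᵐ[μ] fun _ => 1 := by
    filter_upwards [Measure.rnDeriv_zero μ] with x hx
    simp [hx]
  rw [lintegral_congr_ae this]
  simp

theorem HK2_ne_top {n : ℕ} (κ : ℝ) (μ0 μ1 : Measure (Eucl n)) [IsFiniteMeasure μ0]
    [IsFiniteMeasure μ1] : HK2 κ μ0 μ1 ≠ ⊤ := by
  refine ne_top_of_le_ne_top ?_ (iInf₂_le (0 : Measure (Eucl n × Eucl n)) isFiniteMeasureZero)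
  simp [HKfun, KLdiv_zero_left, ENNReal.mul_ne_top, measure_ne_top]

theorem mul_log_sub_self_add_one_nonneg {s : ℝ} (hs : 0 ≤ s) : 0 ≤ s * Real.log s - s + 1 := by
  have := InformationTheory.klFun_nonneg hs
  unfold InformationTheory.klFun at this
  linarith

/-- The entropy density after multiplying its argument by `1 + a`. -/
theorem mul_log_perturb_le {s a : ℝ} (hs : 0 ≤ s) (ha : |a| ≤ 1 / 2) :
    (1 + a) * s * Real.log ((1 + a) * s) - (1 + a) * s + 1 ≤
      (s * Real.log s - s + 1) + (s * (a * Real.log s) + s * a ^ 2) := by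
  have h1 : 0 < 1 + a := by linarith [(abs_le.mp ha).1]
  rcases hs.eq_or_lt with rfl | hs
  · simp
  rw [Real.log_mul h1.ne' hs.ne']
  have h2 := Real.log_le_sub_one_of_pos h1
  nlinarith [mul_le_mul_of_nonneg_left h2 (mul_pos h1 hs).le]

theorem KLdiv_withDensity_one_add {α : Type*} [MeasurableSpace α] (ρ μ : Measure α)
    [IsFiniteMeasure ρ] [IsFiniteMeasure μ] (hac : ρ ≪ μ) (hfin : KLdiv ρ μ ≠ ⊤)
    (a : α → ℝ) (ha : Measurable a) (hbd : ∀ x, |a x| ≤ 1 / 2)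
    (hint : Integrable (fun x => a x * Real.log (ρ.rnDeriv μ x).toReal) ρ) :
    KLdiv (ρ.withDensity fun x => ENNReal.ofReal (1 + a x)) μ ≠ ⊤ ∧
    (KLdiv (ρ.withDensity fun x => ENNReal.ofReal (1 + a x)) μ).toReal ≤
      (KLdiv ρ μ).toReal + (∫ x, a x * Real.log (ρ.rnDeriv μ x).toReal ∂ρ
        + ∫ x, a x ^ 2 ∂ρ) := by
  set s : α → ℝ := fun x => (ρ.rnDeriv μ x).toReal with hs
  have hs0 : ∀ x, 0 ≤ s x := fun x => ENNReal.toReal_nonneg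
  have hsm : Measurable s := (Measure.measurable_rnDeriv ρ μ).ennreal_toReal
  have hF0 : ∀ x, 0 ≤ s x * Real.log (s x) - s x + 1 := fun x =>
    mul_log_sub_self_add_one_nonneg (hs0 x)
  have hFm : Measurable fun x => s x * Real.log (s x) - s x + 1 :=
    ((hsm.mul hsm.log).sub hsm).add_const 1
  have hK : KLdiv ρ μ = ∫⁻ x, ENNReal.ofReal (s x * Real.log (s x) - s x + 1) ∂μ := by
    rw [KLdiv, if_pos hac]
  have hFint : Integrable (fun x => s x * Real.log (s x) - s x + 1) μ := by
    refine ⟨hFm.aestronglyMeasurable, ?_⟩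
    rw [hasFiniteIntegral_iff_ofReal (ae_of_all _ hF0), ← hK]
    exact hfin.lt_top
  have ha2 : Integrable (fun x => a x ^ 2) ρ := by
    refine Integrable.of_bound (ha.pow_const 2).aestronglyMeasurable 1 (ae_of_all _ fun x => ?_)
    have := abs_le.mp (hbd x)
    rw [Real.norm_eq_abs, abs_of_nonneg (sq_nonneg _)]
    nlinarith
  have i1 : Integrable (fun x => s x * (a x * Real.log (s x))) μ :=
    (integrable_rnDeriv_smul_iff hac).mpr hint
  have i2 : Integrable (fun x => s x * a x ^ 2) μ :=
    (integrable_rnDeriv_smul_iff hac).mpr ha2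
  have e1 : ∫ x, s x * (a x * Real.log (s x)) ∂μ = ∫ x, a x * Real.log (s x) ∂ρ :=
    integral_rnDeriv_smul (f := fun x => a x * Real.log (s x)) hac
  have e2 : ∫ x, s x * a x ^ 2 ∂μ = ∫ x, a x ^ 2 ∂ρ :=
    integral_rnDeriv_smul (f := fun x => a x ^ 2) hac
  have hK' : (KLdiv ρ μ).toReal = ∫ x, (s x * Real.log (s x) - s x + 1) ∂μ := by
    rw [hK, integral_eq_lintegral_of_nonneg_ae (ae_of_all _ hF0) hFm.aestronglyMeasurable]
  have hle : KLdiv (ρ.withDensity fun x => ENNReal.ofReal (1 + a x)) μ ≤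
      ENNReal.ofReal (∫ x, ((s x * Real.log (s x) - s x + 1)
        + (s x * (a x * Real.log (s x)) + s x * a x ^ 2)) ∂μ) := by
    rw [KLdiv, if_pos ((withDensity_absolutelyContinuous _ _).trans hac),
      ofReal_integral_eq_lintegral_ofReal (hFint.fun_add (i1.fun_add i2)) (ae_of_all _ fun x => ?_)]
    · refine lintegral_mono_ae ?_
      filter_upwards [Measure.rnDeriv_withDensity_left_of_absolutelyContinuous hac
        (f := fun x => ENNReal.ofReal (1 + a x)) (by fun_prop)] with x hx
      rw [hx, ENNReal.toReal_mul, ENNReal.toReal_ofReal (by linarith [(abs_le.mp (hbd x)).1])]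
      exact ENNReal.ofReal_le_ofReal (mul_log_perturb_le (hs0 x) (hbd x))
    · exact (mul_log_sub_self_add_one_nonneg (mul_nonneg
        (by linarith [(abs_le.mp (hbd x)).1]) (hs0 x))).trans (mul_log_perturb_le (hs0 x) (hbd x))
  refine ⟨ne_top_of_le_ne_top ENNReal.ofReal_ne_top hle, ?_⟩
  rw [hK', ← e1, ← e2, ← integral_add i1 i2, ← integral_add hFint (i1.fun_add i2)]
  refine ENNReal.toReal_le_of_le_ofReal (integral_nonneg fun x => ?_) hle
  exact (mul_log_sub_self_add_one_nonneg (mul_nonneg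
        (by linarith [(abs_le.mp (hbd x)).1]) (hs0 x))).trans (mul_log_perturb_le (hs0 x) (hbd x))

theorem lintegral_withDensity_one_add {α : Type*} [MeasurableSpace α] (ρ : Measure α)
    (f : α → ℝ≥0∞) (hf : Measurable f) (hfin : ∫⁻ x, f x ∂ρ ≠ ⊤)
    (a : α → ℝ) (ha : Measurable a) (hbd : ∀ x, |a x| ≤ 1 / 2) :
    ∫⁻ x, f x ∂(ρ.withDensity fun x => ENNReal.ofReal (1 + a x)) ≠ ⊤ ∧
    (∫⁻ x, f x ∂(ρ.withDensity fun x => ENNReal.ofReal (1 + a x))).toReal =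
      (∫⁻ x, f x ∂ρ).toReal + ∫ x, a x * (f x).toReal ∂ρ := by
  have hfi : Integrable (fun x => (f x).toReal) ρ :=
    integrable_toReal_of_lintegral_ne_top hf.aemeasurable hfin
  have hai : Integrable (fun x => a x * (f x).toReal) ρ :=
    hfi.bdd_mul ha.aestronglyMeasurable (ae_of_all _ hbd)
  have h0 : ∀ x, 0 ≤ (f x).toReal + a x * (f x).toReal := fun x => by
    nlinarith [(abs_le.mp (hbd x)).1, (f x).toReal_nonneg]
  have key : ∫⁻ x, f x ∂(ρ.withDensity fun x => ENNReal.ofReal (1 + a x)) =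
      ENNReal.ofReal (∫ x, ((f x).toReal + a x * (f x).toReal) ∂ρ) := by
    rw [lintegral_withDensity_eq_lintegral_mul _ (by fun_prop) hf,
      ofReal_integral_eq_lintegral_ofReal (hfi.fun_add hai) (ae_of_all _ h0)]
    refine lintegral_congr_ae ?_
    filter_upwards [ae_lt_top hf hfin] with x hx
    have h1 : 0 ≤ 1 + a x := by linarith [(abs_le.mp (hbd x)).1]
    rw [Pi.mul_apply, show (f x).toReal + a x * (f x).toReal = (1 + a x) * (f x).toReal by ring,
      ENNReal.ofReal_mul h1, ENNReal.ofReal_toReal hx.ne]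
  rw [key]
  refine ⟨ENNReal.ofReal_ne_top, ?_⟩
  rw [ENNReal.toReal_ofReal (integral_nonneg h0), integral_add hfi hai, integral_toReal
    hf.aemeasurable (ae_lt_top hf hfin)]

/-- The density of the pushforward of `ρ` restricted to `A` with respect to the pushforward
of `ρ`, truncated at `1`. -/
noncomputable def fiberDensity {α β : Type*} [MeasurableSpace α] [MeasurableSpace β] (ρ : Measure α)
    (T : α → β) (A : Set α) (y : β) : ℝ :=
  min 1 (((ρ.restrict A).map T).rnDeriv (ρ.map T) y).toReal

section fiberDensity

variable {α β : Type*} [MeasurableSpace α] [MeasurableSpace β] (ρ : Measure α)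
    (T : α → β) (A : Set α)

theorem measurable_fiberDensity : Measurable (fiberDensity ρ T A) :=
  measurable_const.min (Measure.measurable_rnDeriv _ _).ennreal_toReal

theorem fiberDensity_nonneg (y : β) : 0 ≤ fiberDensity ρ T A y :=
  le_min zero_le_one ENNReal.toReal_nonneg

theorem fiberDensity_le_one (y : β) : fiberDensity ρ T A y ≤ 1 := min_le_left _ _

variable {T}

theorem restrict_map_le (hT : Measurable T) : (ρ.restrict A).map T ≤ ρ.map T :=
  Measure.map_mono Measure.restrict_le_self hT

variable [IsFiniteMeasure ρ]

theorem fiberDensity_ae_eq (hT : Measurable T) :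
    fiberDensity ρ T A =ᵐ[ρ.map T]
      fun y => (((ρ.restrict A).map T).rnDeriv (ρ.map T) y).toReal := by
  filter_upwards [Measure.rnDeriv_le_one_of_le (restrict_map_le ρ A hT)] with y hy
  exact min_eq_right (ENNReal.toReal_le_of_le_ofReal zero_le_one (by simpa using hy))

theorem integrable_fiberDensity : Integrable (fiberDensity ρ T A) (ρ.map T) :=
  Integrable.of_bound (measurable_fiberDensity ρ T A).aestronglyMeasurable 1
    (ae_of_all _ fun y => by
      rw [Real.norm_eq_abs, abs_of_nonneg (fiberDensity_nonneg ρ T A y)]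
      exact fiberDensity_le_one ρ T A y)

theorem integrable_fiberDensity_mul_iff (hT : Measurable T) (f : β → ℝ) :
    Integrable (fun y => fiberDensity ρ T A y * f y) (ρ.map T) ↔
      Integrable f ((ρ.restrict A).map T) := by
  rw [← integrable_rnDeriv_smul_iff (restrict_map_le ρ A hT).absolutelyContinuous]
  refine integrable_congr ?_
  filter_upwards [fiberDensity_ae_eq ρ A hT] with y hy
  rw [hy, smul_eq_mul]

theorem integral_fiberDensity_mul (hT : Measurable T) (f : β → ℝ) (hf : Measurable f) :
    ∫ y, fiberDensity ρ T A y * f y ∂(ρ.map T) = ∫ x in A, f (T x) ∂ρ := by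
  rw [← integral_map hT.aemeasurable hf.aestronglyMeasurable,
    ← integral_rnDeriv_smul (restrict_map_le ρ A hT).absolutelyContinuous]
  refine integral_congr_ae ?_
  filter_upwards [fiberDensity_ae_eq ρ A hT] with y hy
  rw [hy, smul_eq_mul]

theorem map_withDensity_one_add_indicator (hT : Measurable T) (hA : MeasurableSet A)
    {ε : ℝ} (hε : |ε| ≤ 1 / 2) :
    (ρ.withDensity fun x => ENNReal.ofReal (1 + A.indicator (fun _ => ε) x)).map T =
      (ρ.map T).withDensity fun y => ENNReal.ofReal (1 + ε * fiberDensity ρ T A y) := by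
  have hε' := abs_le.mp hε
  ext B hB
  have i1 : Integrable (A.indicator fun _ => ε) ρ := (integrable_const ε).indicator hA
  have i2 := (integrable_fiberDensity ρ A (T := T)).const_mul ε
  rw [Measure.map_apply hT hB, withDensity_apply _ (hT hB), withDensity_apply _ hB,
    ← ofReal_integral_eq_lintegral_ofReal ((integrable_const 1).fun_add i1.integrableOn)
      (ae_of_all _ fun x => ?_),
    ← ofReal_integral_eq_lintegral_ofReal ((integrable_const 1).fun_add i2.integrableOn)
      (ae_of_all _ fun y => ?_),
    integral_add (integrable_const 1) i1.integrableOn,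
    integral_add (integrable_const 1) i2.integrableOn]
  · congr 2
    · simp [Measure.real, Measure.map_apply hT hB]
    · rw [integral_indicator hA, integral_const_mul,
        integral_congr_ae (ae_restrict_of_ae (fiberDensity_ae_eq ρ A hT)),
        Measure.setIntegral_toReal_rnDeriv (restrict_map_le ρ A hT).absolutelyContinuous]
      simp [Measure.real, Measure.map_apply hT hB, Measure.restrict_apply, hA, hT hB,
        Set.inter_comm, mul_comm]
  · have h1 := fiberDensity_nonneg ρ T A y
    have h2 := fiberDensity_le_one ρ T A y
    simp only [Pi.zero_apply]
    nlinarith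
  · by_cases hx : x ∈ A <;> simp [hx]
    linarith

end fiberDensity

theorem eq_zero_of_forall_nonneg_quadratic {G K : ℝ} (hK : 0 ≤ K)
    (h : ∀ ε : ℝ, |ε| ≤ 1 / 2 → 0 ≤ ε * G + K * ε ^ 2) : G = 0 := by
  have hG := abs_nonneg G
  set D : ℝ := 2 * (K + |G| + 1) with hD
  have hDpos : 0 < D := by positivity
  have h1 := h (-G / D) (by
    rw [abs_div, abs_neg, abs_of_pos hDpos, div_le_iff₀ hDpos]
    linarith)
  have h2 : -G / D * G + K * (-G / D) ^ 2 = G ^ 2 * (K - D) / D ^ 2 := by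
    field_simp
    ring
  rw [h2, le_div_iff₀ (by positivity), zero_mul] at h1
  have h3 : K - D < 0 := by linarith
  have h4 : G ^ 2 ≤ 0 := by nlinarith
  exact pow_eq_zero_iff (two_ne_zero) |>.mp (le_antisymm h4 (sq_nonneg G))

/-- A direct route to Lebesgue decompositions: on Euclidean space, instance search finds terms that
exceed the size limit. -/
theorem haveLebesgueDecomposition_of_isFiniteMeasure {α : Type*} [MeasurableSpace α]
    (μ ν : Measure α) [IsFiniteMeasure μ] [IsFiniteMeasure ν] : μ.HaveLebesgueDecomposition ν :=
  inferInstance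

section Optimality

variable {n : ℕ} {κ : ℝ} {μ0 μ1 ρ : Measure (Eucl n)} {T : Eucl n → Eucl n}

theorem map_snd_graph (hT : Measurable T) (ρ : Measure (Eucl n)) :
    (ρ.map fun x => (x, T x)).map Prod.snd = ρ.map T := by
  rw [Measure.map_map measurable_snd (by fun_prop)]
  rfl

theorem map_fst_graph (hT : Measurable T) (ρ : Measure (Eucl n)) :
    (ρ.map fun x => (x, T x)).map Prod.fst = ρ := by
  rw [Measure.map_map measurable_fst (by fun_prop)]
  exact Measure.map_id

theorem measurable_cHK_graph (κ : ℝ) (hT : Measurable T) :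
    Measurable fun x => cHK κ x (T x) := by
  have hg : Measurable fun x => (x, T x) := by fun_prop
  have h := (measurable_cHK (n := n) κ).comp hg
  exact h

theorem HKfun_graph (hT : Measurable T) (ρ : Measure (Eucl n)) :
    HKfun κ (ρ.map fun x => (x, T x)) μ0 μ1 =
      ∫⁻ x, cHK κ x (T x) ∂ρ + ENNReal.ofReal (κ ^ 2) * KLdiv ρ μ0
        + ENNReal.ofReal (κ ^ 2) * KLdiv (ρ.map T) μ1 := by
  rw [HKfun, map_fst_graph hT, map_snd_graph hT,
    lintegral_map (measurable_cHK κ) (by fun_prop)]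

theorem HKfun_graph_finite (hκ : 0 < κ) (hT : Measurable T)
    (hfin : HKfun κ (ρ.map fun x => (x, T x)) μ0 μ1 ≠ ⊤) :
    ∫⁻ x, cHK κ x (T x) ∂ρ ≠ ⊤ ∧ KLdiv ρ μ0 ≠ ⊤ ∧ KLdiv (ρ.map T) μ1 ≠ ⊤ := by
  rw [HKfun_graph hT] at hfin
  simp only [ne_eq, ENNReal.add_eq_top, not_or, ENNReal.mul_eq_top, not_and, ENNReal.ofReal_eq_zero,
    not_le] at hfin
  exact ⟨hfin.1.1, hfin.1.2.1 (by positivity), hfin.2.1 (by positivity)⟩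

theorem absolutelyContinuous_of_KLdiv_ne_top {α : Type*} [MeasurableSpace α] {ρ μ : Measure α}
    (h : KLdiv ρ μ ≠ ⊤) : ρ ≪ μ := by
  by_contra hc
  exact h (if_neg hc)

variable [IsFiniteMeasure μ0] [IsFiniteMeasure μ1] [IsFiniteMeasure ρ]

/-- First-order condition for a minimizer concentrated on a graph. -/
theorem setIntegral_firstVariation_eq_zero (hκ : 0 < κ) (hT : Measurable T)
    (hfin : HKfun κ (ρ.map fun x => (x, T x)) μ0 μ1 ≠ ⊤)
    (hopt : ∀ π' : Measure (Eucl n × Eucl n), IsFiniteMeasure π' →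
      HKfun κ (ρ.map fun x => (x, T x)) μ0 μ1 ≤ HKfun κ π' μ0 μ1)
    {A : Set (Eucl n)} (hA : MeasurableSet A)
    (h0 : IntegrableOn (fun x => Real.log (ρ.rnDeriv μ0 x).toReal) A ρ)
    (h1 : IntegrableOn (fun x => Real.log ((ρ.map T).rnDeriv μ1 (T x)).toReal) A ρ) :
    ∫ x in A, ((cHK κ x (T x)).toReal + κ ^ 2 * (Real.log (ρ.rnDeriv μ0 x).toReal
      + Real.log ((ρ.map T).rnDeriv μ1 (T x)).toReal)) ∂ρ = 0 := by
  obtain ⟨hC, hK0, hK1⟩ := HKfun_graph_finite hκ hT hfin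
  have hac0 := absolutelyContinuous_of_KLdiv_ne_top hK0
  have hac1 := absolutelyContinuous_of_KLdiv_ne_top hK1
  have hcm := measurable_cHK_graph κ hT
  have hci : Integrable (fun x => (cHK κ x (T x)).toReal) ρ :=
    integrable_toReal_of_lintegral_ne_top hcm.aemeasurable hC
  have hl1m : Measurable fun y => Real.log ((ρ.map T).rnDeriv μ1 y).toReal :=
    (Measure.measurable_rnDeriv _ _).ennreal_toReal.log
  rw [integral_add hci.integrableOn ((h0.fun_add h1).const_mul _), integral_const_mul,
    integral_add h0 h1]
  refine eq_zero_of_forall_nonneg_quadratic (K := 2 * κ ^ 2 * ρ.real A) (by positivity)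
    fun ε hε => ?_
  have hind : ∀ f : Eucl n → ℝ,
      (fun x => A.indicator (fun _ => ε) x * f x) = A.indicator fun x => ε * f x := by
    intro f
    ext x
    by_cases hx : x ∈ A <;> simp [hx]
  have hbd : ∀ x, |A.indicator (fun _ => ε) x| ≤ 1 / 2 := fun x => by
    by_cases hx : x ∈ A <;> simp [hx]
    linarith
  have ham : Measurable (A.indicator fun _ : Eucl n => ε) := measurable_const.indicator hA
  have hbd' : ∀ y, |ε * fiberDensity ρ T A y| ≤ 1 / 2 := fun y => by
    rw [abs_mul, abs_of_nonneg (fiberDensity_nonneg ρ T A y)]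
    exact (mul_le_of_le_one_right (abs_nonneg ε) (fiberDensity_le_one ρ T A y)).trans hε
  obtain ⟨hC', eC⟩ := lintegral_withDensity_one_add ρ _ hcm hC _ ham hbd
  obtain ⟨hK0', e0⟩ := KLdiv_withDensity_one_add ρ μ0 hac0 hK0 _ ham hbd (by
    rw [hind]
    exact (integrable_indicator_iff hA).mpr (h0.const_mul ε))
  obtain ⟨hK1', e1⟩ := KLdiv_withDensity_one_add (ρ.map T) μ1 hac1 hK1
    (fun y => ε * fiberDensity ρ T A y) ((measurable_fiberDensity ρ T A).const_mul ε) hbd' (by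
    simp only [mul_assoc]
    refine Integrable.const_mul ?_ ε
    rw [integrable_fiberDensity_mul_iff ρ A hT,
      integrable_map_measure hl1m.aestronglyMeasurable hT.aemeasurable]
    exact h1)
  rw [← map_withDensity_one_add_indicator ρ A hT hA hε] at hK1' e1
  have hle := hopt ((ρ.withDensity fun x =>
    ENNReal.ofReal (1 + A.indicator (fun _ => ε) x)).map fun x => (x, T x)) (by
      have : IsFiniteMeasure (ρ.withDensity fun x =>
          ENNReal.ofReal (1 + A.indicator (fun _ => ε) x)) :=
        isFiniteMeasure_withDensity_ofReal
          ((integrable_const 1).add ((integrable_const ε).indicator hA)).2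
      infer_instance)
  rw [HKfun_graph hT, HKfun_graph hT] at hle
  have hle' := ENNReal.toReal_mono (by simp [hC', hK0', hK1', ENNReal.mul_ne_top]) hle
  rw [ENNReal.toReal_add (by simp [hC, hK0, ENNReal.mul_ne_top])
      (by simp [hK1, ENNReal.mul_ne_top]),
    ENNReal.toReal_add hC (by simp [hK0, ENNReal.mul_ne_top]),
    ENNReal.toReal_add (by simp [hC', hK0', ENNReal.mul_ne_top])
      (by simp [hK1', ENNReal.mul_ne_top]),
    ENNReal.toReal_add hC' (by simp [hK0', ENNReal.mul_ne_top])] at hle'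
  simp only [ENNReal.toReal_mul, ENNReal.toReal_ofReal (sq_nonneg κ)] at hle'
  rw [hind, integral_indicator hA, integral_const_mul] at eC e0
  have q0 : ∫ x, A.indicator (fun _ => ε) x ^ 2 ∂ρ = ε ^ 2 * ρ.real A := by
    have : (fun x => A.indicator (fun _ => ε) x ^ 2) = A.indicator fun _ => ε ^ 2 := by
      ext x
      by_cases hx : x ∈ A <;> simp [hx]
    rw [this, integral_indicator hA]
    simp [mul_comm]
  have q1 : ∫ y, (ε * fiberDensity ρ T A y) ^ 2 ∂(ρ.map T) ≤ ε ^ 2 * ρ.real A := by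
    have e : ∫ y, ε ^ 2 * fiberDensity ρ T A y ∂(ρ.map T) = ε ^ 2 * ρ.real A := by
      rw [integral_const_mul]
      have := integral_fiberDensity_mul ρ A hT (fun _ => 1) measurable_const
      simp only [mul_one] at this
      rw [this]
      simp
    rw [← e]
    refine integral_mono_of_nonneg (ae_of_all _ fun y => sq_nonneg _)
      ((integrable_fiberDensity ρ A).const_mul _) (ae_of_all _ fun y => ?_)
    have b0 := fiberDensity_nonneg ρ T A y
    have b1 := fiberDensity_le_one ρ T A y
    simp only [mul_pow]
    exact mul_le_mul_of_nonneg_left (by nlinarith) (sq_nonneg ε)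
  have l1 : ∫ y, ε * fiberDensity ρ T A y * Real.log ((ρ.map T).rnDeriv μ1 y).toReal ∂(ρ.map T)
      = ε * ∫ x in A, Real.log ((ρ.map T).rnDeriv μ1 (T x)).toReal ∂ρ := by
    simp only [mul_assoc]
    rw [integral_const_mul, integral_fiberDensity_mul ρ A hT _ hl1m]
  rw [l1] at e1
  rw [q0] at e0
  have hκ2 := sq_nonneg κ
  have m0 := mul_le_mul_of_nonneg_left e0 hκ2
  have m1 := mul_le_mul_of_nonneg_left (e1.trans (add_le_add_right (add_le_add_right q1 _) _)) hκ2
  linarith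

/-- The optimality relation `(dρ/dμ0) (dT_#ρ/dμ1 ∘ T) = cos² (|T - id| / κ)`. -/
theorem rnDeriv_mul_rnDeriv_eq_cos_sq (hκ : 0 < κ) (hT : Measurable T)
    (hfin : HKfun κ (ρ.map fun x => (x, T x)) μ0 μ1 ≠ ⊤)
    (hopt : ∀ π' : Measure (Eucl n × Eucl n), IsFiniteMeasure π' →
      HKfun κ (ρ.map fun x => (x, T x)) μ0 μ1 ≤ HKfun κ π' μ0 μ1) :
    ∀ᵐ x ∂ρ, 0 < (ρ.rnDeriv μ0 x).toReal ∧ 0 < ((ρ.map T).rnDeriv μ1 (T x)).toReal ∧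
      ‖T x - x‖ / κ < Real.pi / 2 ∧
      (ρ.rnDeriv μ0 x).toReal * ((ρ.map T).rnDeriv μ1 (T x)).toReal =
        Real.cos (‖T x - x‖ / κ) ^ 2 := by
  obtain ⟨hC, hK0, hK1⟩ := HKfun_graph_finite hκ hT hfin
  have := haveLebesgueDecomposition_of_isFiniteMeasure ρ μ0
  have := haveLebesgueDecomposition_of_isFiniteMeasure (ρ.map T) μ1
  have hac0 := absolutelyContinuous_of_KLdiv_ne_top hK0
  have hac1 := absolutelyContinuous_of_KLdiv_ne_top hK1
  have hcm := measurable_cHK_graph κ hT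
  have hl0m : Measurable fun x => Real.log (ρ.rnDeriv μ0 x).toReal :=
    (Measure.measurable_rnDeriv _ _).ennreal_toReal.log
  have hl1m : Measurable fun x => Real.log ((ρ.map T).rnDeriv μ1 (T x)).toReal :=
    ((Measure.measurable_rnDeriv _ _).comp hT).ennreal_toReal.log
  have hci : Integrable (fun x => (cHK κ x (T x)).toReal) ρ :=
    integrable_toReal_of_lintegral_ne_top hcm.aemeasurable hC
  have hzero : ∀ᵐ x ∂ρ, (cHK κ x (T x)).toReal + κ ^ 2 * (Real.log (ρ.rnDeriv μ0 x).toReal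
      + Real.log ((ρ.map T).rnDeriv μ1 (T x)).toReal) = 0 := by
    let B : ℕ → Set (Eucl n) := fun k => {x | |Real.log (ρ.rnDeriv μ0 x).toReal| ≤ k ∧
      |Real.log ((ρ.map T).rnDeriv μ1 (T x)).toReal| ≤ k}
    have hB : ∀ k, MeasurableSet (B k) := fun k =>
      (measurableSet_le hl0m.abs measurable_const).inter
        (measurableSet_le hl1m.abs measurable_const)
    have hBk : ∀ k : ℕ, ∀ᵐ x ∂ρ, x ∈ B k → (cHK κ x (T x)).toReal
        + κ ^ 2 * (Real.log (ρ.rnDeriv μ0 x).toReal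
          + Real.log ((ρ.map T).rnDeriv μ1 (T x)).toReal) = 0 := by
      intro k
      have i0 : IntegrableOn (fun x => Real.log (ρ.rnDeriv μ0 x).toReal) (B k) ρ :=
        Integrable.of_bound hl0m.aestronglyMeasurable k
          ((ae_restrict_iff' (hB k)).mpr (ae_of_all _ fun x hx => hx.1))
      have i1 : IntegrableOn (fun x => Real.log ((ρ.map T).rnDeriv μ1 (T x)).toReal) (B k) ρ :=
        Integrable.of_bound hl1m.aestronglyMeasurable k
          ((ae_restrict_iff' (hB k)).mpr (ae_of_all _ fun x hx => hx.2))
      rw [← ae_restrict_iff' (hB k)]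
      refine Integrable.ae_eq_zero_of_forall_setIntegral_eq_zero
        (hci.integrableOn.fun_add ((i0.fun_add i1).const_mul _)) fun s hs _ => ?_
      rw [Measure.restrict_restrict hs]
      exact setIntegral_firstVariation_eq_zero hκ hT hfin hopt (hs.inter (hB k))
        (i0.mono_set Set.inter_subset_right) (i1.mono_set Set.inter_subset_right)
    filter_upwards [ae_all_iff.mpr hBk] with x hx
    obtain ⟨k, hk⟩ := exists_nat_ge (max |Real.log (ρ.rnDeriv μ0 x).toReal|
      |Real.log ((ρ.map T).rnDeriv μ1 (T x)).toReal|)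
    exact hx k ⟨(le_max_left _ _).trans hk, (le_max_right _ _).trans hk⟩
  filter_upwards [hzero, ae_lt_top hcm hC, Measure.rnDeriv_pos hac0,
    hac0.ae_le (Measure.rnDeriv_lt_top ρ μ0),
    ae_of_ae_map hT.aemeasurable (Measure.rnDeriv_pos hac1),
    ae_of_ae_map hT.aemeasurable (hac1.ae_le (Measure.rnDeriv_lt_top (ρ.map T) μ1))]
    with x hx hc p0 t0 p1 t1
  have s0 := ENNReal.toReal_pos p0.ne' t0.ne
  have s1 := ENNReal.toReal_pos p1.ne' t1.ne
  have hd : dist x (T x) < κ * Real.pi / 2 := by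
    by_contra hcon
    rw [cHK, if_neg hcon] at hc
    exact lt_irrefl _ hc
  have hde : dist x (T x) = ‖T x - x‖ := by rw [dist_comm, dist_eq_norm]
  have hlt : ‖T x - x‖ / κ < Real.pi / 2 := by
    rw [div_lt_iff₀ hκ, ← hde]
    linarith
  have hge : 0 ≤ ‖T x - x‖ / κ := by positivity
  have hcos : 0 < Real.cos (‖T x - x‖ / κ) :=
    Real.cos_pos_of_mem_Ioo ⟨by linarith [Real.pi_pos], hlt⟩
  refine ⟨s0, s1, hlt, ?_⟩
  have hlog : Real.log (Real.cos (‖T x - x‖ / κ)) ≤ 0 :=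
    Real.log_nonpos hcos.le (Real.cos_le_one _)
  rw [cHK, if_pos hd, hde, ENNReal.toReal_ofReal (by nlinarith [sq_nonneg κ])] at hx
  refine Real.log_injOn_pos (Set.mem_Ioi.mpr (mul_pos s0 s1)) (Set.mem_Ioi.mpr (by positivity)) ?_
  rw [Real.log_mul s0.ne' s1.ne', Real.log_pow]
  have hk2 : κ ^ 2 ≠ 0 := by positivity
  apply mul_left_cancel₀ hk2
  push_cast
  linarith

end Optimality

theorem map_withDensity_comp {α β : Type*} [MeasurableSpace α] [MeasurableSpace β]
    (ρ : Measure α) {T : α → β} (hT : Measurable T) {f : β → ℝ≥0∞} (hf : Measurable f) :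
    (ρ.withDensity fun x => f (T x)).map T = (ρ.map T).withDensity f := by
  ext B hB
  rw [Measure.map_apply hT hB, withDensity_apply _ (hT hB), withDensity_apply _ hB,
    setLIntegral_map hB hf hT]

/-- The exponential map inverts the logarithmic map at a point where the transport is active. -/
theorem exp_log_pointwise {E : Type*} [NormedAddCommGroup E] [NormedSpace ℝ E] {κ s s' a : ℝ}
    (hκ : 0 < κ) (hs : 0 < s) (hs' : 0 < s') {w v : E} (hlt : ‖w‖ / κ < Real.pi / 2)
    (hcos : s * s' = Real.cos (‖w‖ / κ) ^ 2)
    (hv : v = (κ * s * Real.tan (‖w‖ / κ) / ‖w‖) • w) (ha : a = 2 * (s - 1)) :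
    (if v = 0 then 0 else
      (κ * Real.arctan ((1 / κ) * (‖v‖ / (1 + a / 2))) / ‖v‖) • v) = w ∧
    (1 + a / 2) ^ 2 + ‖v‖ ^ 2 / κ ^ 2 = s * s'⁻¹ := by
  have h1 : 1 + a / 2 = s := by rw [ha]; ring
  rw [h1]
  have hge : 0 ≤ ‖w‖ / κ := by positivity
  have hgt : -(Real.pi / 2) < ‖w‖ / κ := by linarith [Real.pi_pos]
  have hc : 0 < Real.cos (‖w‖ / κ) := Real.cos_pos_of_mem_Ioo ⟨hgt, hlt⟩
  have ht : 0 ≤ Real.tan (‖w‖ / κ) := Real.tan_nonneg_of_nonneg_of_le_pi_div_two hge hlt.le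
  have hnv : ‖v‖ = κ * s * Real.tan (‖w‖ / κ) := by
    rcases eq_or_ne w 0 with rfl | hw
    · simp [hv]
    · rw [hv, norm_smul, Real.norm_eq_abs, abs_of_nonneg (by positivity),
        div_mul_cancel₀ _ (norm_ne_zero_iff.mpr hw)]
  constructor
  · rcases eq_or_ne w 0 with rfl | hw
    · simp [hv]
    · have hwn : 0 < ‖w‖ := norm_pos_iff.mpr hw
      have htp : 0 < Real.tan (‖w‖ / κ) := Real.tan_pos_of_pos_of_lt_pi_div_two (by positivity) hlt
      have hvn : 0 < ‖v‖ := by rw [hnv]; positivity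
      rw [if_neg (norm_pos_iff.mp hvn)]
      have harg : 1 / κ * (‖v‖ / s) = Real.tan (‖w‖ / κ) := by
        rw [hnv]
        field_simp
      rw [harg, Real.arctan_tan hgt hlt, hnv, hv, smul_smul]
      convert one_smul ℝ w using 2
      field_simp
  · have h2 : (1 + Real.tan (‖w‖ / κ) ^ 2) * Real.cos (‖w‖ / κ) ^ 2 = 1 := by
      rw [Real.tan_eq_sin_div_cos]
      field_simp
      exact Real.cos_sq_add_sin_sq _
    rw [← hcos] at h2
    have h3 : s ^ 2 + ‖v‖ ^ 2 / κ ^ 2 = s ^ 2 * (1 + Real.tan (‖w‖ / κ) ^ 2) := by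
      rw [hnv]
      field_simp
    rw [h3, eq_mul_inv_iff_mul_eq₀ hs'.ne']
    linear_combination s * h2

/-- the HK exponential map is a left inverse of the HK logarithmic map. -/
theorem hk_exp_left_inverse_of_log
    {n : ℕ} (hn : 1 ≤ n) (κ : ℝ) (hκ : 0 < κ)
    (μ0 μ1 : Measure (Eucl n)) [IsFiniteMeasure μ0] [IsFiniteMeasure μ1]
    (hμ0K : ∃ K : Set (Eucl n), IsCompact K ∧ μ0 Kᶜ = 0)
    (hμ1K : ∃ K : Set (Eucl n), IsCompact K ∧ μ1 Kᶜ = 0)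
    (hμ0ac : μ0 ≪ (volume : Measure (Eucl n)))
    -- `π = (id,T)_# π0` is the unique minimizer of `E_κ(·|μ0,μ1)`
    (π : Measure (Eucl n × Eucl n)) [IsFiniteMeasure π]
    (hπopt : HKfun κ π μ0 μ1 = HK2 κ μ0 μ1)
    (hπuniq : ∀ π' : Measure (Eucl n × Eucl n), IsFiniteMeasure π' →
      HKfun κ π' μ0 μ1 = HK2 κ μ0 μ1 → π' = π)
    (T : Eucl n → Eucl n) (hT : Measurable T)
    (hπT : π = (π.map Prod.fst).map (fun x => (x, T x)))
    -- the components `(v0, α0, μ1^⊥)` of the HK logarithmic map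
    (v0 : Eucl n → Eucl n) (α0 : Eucl n → ℝ)
    (hv0m : Measurable v0) (hα0m : Measurable α0)
    (hv0 : ∀ᵐ x ∂(π.map Prod.fst), v0 x =
      (κ * ((π.map Prod.fst).rnDeriv μ0 x).toReal * Real.tan (‖T x - x‖ / κ) / ‖T x - x‖) •
        (T x - x))
    (hv0perp : ∀ᵐ x ∂(μ0.singularPart (π.map Prod.fst)), v0 x = 0)
    (hα0 : ∀ᵐ x ∂(π.map Prod.fst),
      α0 x = 2 * (((π.map Prod.fst).rnDeriv μ0 x).toReal - 1))
    (hα0perp : ∀ᵐ x ∂(μ0.singularPart (π.map Prod.fst)), α0 x = -2)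
    -- the transport map `T'` and mass-change field `u` of the HK exponential map
    (T' : Eucl n → Eucl n)
    (hT' : T' = fun x => if v0 x = 0 then x else
      x + (κ * Real.arctan ((1 / κ) * (‖v0 x‖ / (1 + α0 x / 2))) / ‖v0 x‖) • v0 x)
    (u : Eucl n → ℝ)
    (hu : u = fun x => Real.sqrt ((1 + α0 x / 2) ^ 2 + ‖v0 x‖ ^ 2 / κ ^ 2)) :
    (μ0.withDensity fun x => ENNReal.ofReal (u x ^ 2)).map T'
      + μ1.singularPart (π.map Prod.snd) = μ1 := by
  set ρ : Measure (Eucl n) := π.map Prod.fst with hρ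
  have : IsFiniteMeasure ρ := by
    rw [hρ]
    infer_instance
  have := haveLebesgueDecomposition_of_isFiniteMeasure μ0 ρ
  have := haveLebesgueDecomposition_of_isFiniteMeasure μ1 (ρ.map T)
  have hsnd : π.map Prod.snd = ρ.map T := by
    conv_lhs => rw [hπT]
    exact map_snd_graph hT ρ
  have hfin : HKfun κ (ρ.map fun x => (x, T x)) μ0 μ1 ≠ ⊤ := by
    rw [← hπT, hπopt]
    exact HK2_ne_top κ μ0 μ1
  have hopt : ∀ π' : Measure (Eucl n × Eucl n), IsFiniteMeasure π' →
      HKfun κ (ρ.map fun x => (x, T x)) μ0 μ1 ≤ HKfun κ π' μ0 μ1 := by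
    intro π' hπ'
    rw [← hπT, hπopt]
    exact iInf₂_le π' hπ'
  obtain ⟨-, hK0, hK1⟩ := HKfun_graph_finite hκ hT hfin
  have hac0 := absolutelyContinuous_of_KLdiv_ne_top hK0
  have hac1 := absolutelyContinuous_of_KLdiv_ne_top hK1
  rw [hsnd]
  have hum : Measurable fun x => ENNReal.ofReal (u x ^ 2) := by
    rw [hu]
    fun_prop
  have hT'm : Measurable T' := by
    rw [hT']
    refine Measurable.ite (hv0m (measurableSet_singleton 0)) measurable_id ?_
    fun_prop
  have hpt : ∀ᵐ x ∂ρ, T' x = T x ∧ μ0.rnDeriv ρ x * ENNReal.ofReal (u x ^ 2)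
      = μ1.rnDeriv (ρ.map T) (T x) := by
    filter_upwards [rnDeriv_mul_rnDeriv_eq_cos_sq hκ hT hfin hopt, hv0, hα0,
      Measure.inv_rnDeriv hac0, ae_of_ae_map hT.aemeasurable (Measure.inv_rnDeriv hac1)]
      with x hx hv ha hi0 hi1
    obtain ⟨p0, p1, hlt, hcos⟩ := hx
    obtain ⟨e1, e2⟩ := exp_log_pointwise hκ p0 p1 hlt hcos hv ha
    constructor
    · rw [hT']
      dsimp only
      split_ifs at e1 ⊢ with h
      · rw [eq_comm, ← sub_eq_zero, ← e1]
      · rw [e1, add_sub_cancel]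
    · have hu2 : u x ^ 2 = (ρ.rnDeriv μ0 x).toReal * ((ρ.map T).rnDeriv μ1 (T x)).toReal⁻¹ := by
        rw [hu]
        dsimp only
        rw [Real.sq_sqrt (by positivity), e2]
      obtain ⟨p0', t0⟩ := ENNReal.toReal_pos_iff.mp p0
      obtain ⟨p1', t1⟩ := ENNReal.toReal_pos_iff.mp p1
      rw [← hi0, ← hi1, hu2, ENNReal.ofReal_mul p0.le, ENNReal.ofReal_toReal t0.ne,
        ENNReal.ofReal_inv_of_pos p1, ENNReal.ofReal_toReal t1.ne, Pi.inv_apply, Pi.inv_apply,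
        ← mul_assoc, ENNReal.inv_mul_cancel p0'.ne' t0.ne, one_mul]
  have hperp : (μ0.singularPart ρ).withDensity (fun x => ENNReal.ofReal (u x ^ 2)) = 0 := by
    rw [withDensity_eq_zero_iff hum.aemeasurable]
    filter_upwards [hv0perp, hα0perp] with x hv ha
    simp [hu, hv, ha]
  have hac : (ρ.withDensity (μ0.rnDeriv ρ)).withDensity (fun x => ENNReal.ofReal (u x ^ 2))
      = ρ.withDensity fun x => μ1.rnDeriv (ρ.map T) (T x) := by
    rw [← withDensity_mul _ (Measure.measurable_rnDeriv _ _) hum]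
    exact withDensity_congr_ae (hpt.mono fun x hx => hx.2)
  have hdens : μ0.withDensity (fun x => ENNReal.ofReal (u x ^ 2))
      = ρ.withDensity fun x => μ1.rnDeriv (ρ.map T) (T x) := by
    conv_lhs => rw [Measure.haveLebesgueDecomposition_add μ0 ρ]
    rw [withDensity_add_measure, hperp, zero_add, hac]
  have hTT' : T' =ᵐ[ρ.withDensity fun x => μ1.rnDeriv (ρ.map T) (T x)] T :=
    (withDensity_absolutelyContinuous ρ _).ae_le (hpt.mono fun x hx => hx.1)
  rw [hdens, Measure.map_congr hTT',
    map_withDensity_comp ρ hT (Measure.measurable_rnDeriv _ _)]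
  exact Measure.rnDeriv_add_singularPart μ1 (ρ.map T)
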